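/- Let k be a field of characteristic 2 and let A = k[X, Y]/(Y² − Y·X²), with x and y denoting the images of X and Y. Then: (a) there is a (unique) k-linear derivation D₀ : A → A with D₀(x) = 1 and D₀(y) = 0 (induced by ∂/∂X, which is well defined on A since ∂(Y² − YX²)/∂X = −2XY = 0 in characteristic 2); (b) every k-linear derivation D : A → A satisfies D(y) = 0 and D = D(x)·D₀; consequently the A-module of k-linear derivations of A is free of rank one, generated by D₀. -/

import Mathlib

set_option synthInstance.maxHeartbeats 400000
set_option maxHeartbeats 1000000

noncomputable section

open MvPolynomial

/-- The affine coordinate ring `A = k[X,Y]/(Y² − Y X²)` of the tacnode. -/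
abbrev TnAlg (k : Type*) [Field k] :=
  MvPolynomial (Fin 2) k ⧸
    Ideal.span {(X 1 ^ 2 - X 1 * X 0 ^ 2 : MvPolynomial (Fin 2) k)}

/-- The image `x` of `X` in `A`. -/
def tnX (k : Type*) [Field k] : TnAlg k :=
  Ideal.Quotient.mk (Ideal.span {(X 1 ^ 2 - X 1 * X 0 ^ 2 : MvPolynomial (Fin 2) k)}) (X 0)

/-- The image `y` of `Y` in `A`. -/
def tnY (k : Type*) [Field k] : TnAlg k :=
  Ideal.Quotient.mk (Ideal.span {(X 1 ^ 2 - X 1 * X 0 ^ 2 : MvPolynomial (Fin 2) k)}) (X 1)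

theorem tnAlg_two_eq_zero (k : Type*) [Field k] [CharP k 2] : (2 : TnAlg k) = 0 := by
  have h : (2 : k) = 0 := by exact_mod_cast CharP.cast_eq_zero k 2
  rw [← map_ofNat (algebraMap k (TnAlg k)) 2, h, map_zero]

theorem tnY_sq (k : Type*) [Field k] : tnY k ^ 2 = tnY k * tnX k ^ 2 := by
  have h : Ideal.Quotient.mk (Ideal.span {(X 1 ^ 2 - X 1 * X 0 ^ 2 : MvPolynomial (Fin 2) k)})
      (X 1 ^ 2 - X 1 * X 0 ^ 2) = 0 :=
    Ideal.Quotient.eq_zero_iff_mem.mpr (Ideal.mem_span_singleton_self _)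
  rw [map_sub, map_mul, map_pow, map_pow] at h
  exact sub_eq_zero.mp h

/-- The class `x` is a nonzerodivisor of the tacnode ring. -/
theorem eq_zero_of_tnX_mul_eq_zero {k : Type*} [Field k] {a : TnAlg k} (h : tnX k * a = 0) :
    a = 0 := by
  obtain ⟨f, rfl⟩ := Ideal.Quotient.mk_surjective a
  rw [tnX, ← map_mul, Ideal.Quotient.eq_zero_iff_mem, Ideal.mem_span_singleton] at h
  rw [Ideal.Quotient.eq_zero_iff_mem, Ideal.mem_span_singleton]
  obtain ⟨g, hg⟩ := h
  have hX : Prime (X 0 : MvPolynomial (Fin 2) k) := X_prime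
  rcases hX.dvd_or_dvd (Dvd.intro f hg) with ⟨q, hq⟩ | ⟨q, rfl⟩
  · have := congrArg (eval ![0, 1]) hq
    simp at this
  · exact ⟨q, mul_left_cancel₀ hX.ne_zero (by rw [hg]; ring)⟩

/-- A derivation of the tacnode ring is determined by its values on `x` and `y`. -/
theorem tnAlg_derivation_ext {k : Type*} [Field k] {D₁ D₂ : Derivation k (TnAlg k) (TnAlg k)}
    (hx : D₁ (tnX k) = D₂ (tnX k)) (hy : D₁ (tnY k) = D₂ (tnY k)) : D₁ = D₂ := by
  ext a
  obtain ⟨f, rfl⟩ := Ideal.Quotient.mk_surjective a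
  have h : D₁.compAlgebraMap (MvPolynomial (Fin 2) k) =
      D₂.compAlgebraMap (MvPolynomial (Fin 2) k) := by
    refine derivation_ext fun i => ?_
    fin_cases i
    · exact hx
    · exact hy
  exact Derivation.congr_fun h f

theorem derivation_tnY_eq_zero {k : Type*} [Field k] [CharP k 2]
    (D : Derivation k (TnAlg k) (TnAlg k)) : D (tnY k) = 0 := by
  have h := congrArg D (tnY_sq k)
  simp only [Derivation.leibniz, Derivation.leibniz_pow, smul_eq_mul, nsmul_eq_mul,
    Nat.cast_ofNat, tnAlg_two_eq_zero, zero_mul, mul_zero, zero_add] at h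
  apply eq_zero_of_tnX_mul_eq_zero
  apply eq_zero_of_tnX_mul_eq_zero
  rw [← mul_assoc, ← pow_two, ← h]

theorem mk_pderiv_eq_zero {k : Type*} [Field k] [CharP k 2] (f : MvPolynomial (Fin 2) k)
    (hf : Ideal.Quotient.mkₐ k
      (Ideal.span {(X 1 ^ 2 - X 1 * X 0 ^ 2 : MvPolynomial (Fin 2) k)}) f = 0) :
    Ideal.Quotient.mkₐ k
      (Ideal.span {(X 1 ^ 2 - X 1 * X 0 ^ 2 : MvPolynomial (Fin 2) k)}) (pderiv 0 f) = 0 := by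
  rw [Ideal.Quotient.mkₐ_eq_mk, Ideal.Quotient.eq_zero_iff_mem, Ideal.mem_span_singleton] at *
  obtain ⟨g, rfl⟩ := hf
  have h : pderiv 0 (X 1 ^ 2 - X 1 * X 0 ^ 2 : MvPolynomial (Fin 2) k) = 0 := by
    have h2 : (2 : MvPolynomial (Fin 2) k) = 0 := by
      exact_mod_cast CharP.cast_eq_zero (MvPolynomial (Fin 2) k) 2
    simp [Derivation.leibniz, Derivation.leibniz_pow, pderiv_X, h2]
  rw [Derivation.leibniz, h, smul_zero, add_zero, smul_eq_mul]
  exact dvd_mul_right _ _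

/-- The derivation of the tacnode ring induced by `∂/∂X` in characteristic `2`. -/
def tnDerivX (k : Type*) [Field k] [CharP k 2] : Derivation k (TnAlg k) (TnAlg k) :=
  Derivation.liftOfSurjective (Ideal.Quotient.mkₐ_surjective k _) mk_pderiv_eq_zero

theorem tnDerivX_mk {k : Type*} [Field k] [CharP k 2] (f : MvPolynomial (Fin 2) k) :
    tnDerivX k (Ideal.Quotient.mk _ f) = Ideal.Quotient.mk _ (pderiv 0 f) :=
  Derivation.liftOfSurjective_apply (Ideal.Quotient.mkₐ_surjective k _) mk_pderiv_eq_zero f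

theorem tnDerivX_tnX (k : Type*) [Field k] [CharP k 2] : tnDerivX k (tnX k) = 1 := by
  rw [tnX, tnDerivX_mk, pderiv_X_self, map_one]

/-- over a field of characteristic `2`, the tacnode
`A = k[X,Y]/(Y² − Y X²)` has a unique `k`-derivation `D₀` with `D₀(x) = 1`, `D₀(y) = 0`
(induced by `∂/∂X`), and every `k`-derivation `D : A → A` satisfies `D(y) = 0` and
`D = D(x) • D₀`; so the `A`-module of `k`-derivations of `A` is free of rank one on `D₀`. -/
theorem stmt13 (k : Type*) [Field k] [CharP k 2] :
    ∃ D0 : Derivation k (TnAlg k) (TnAlg k),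
      (D0 (tnX k) = 1 ∧ D0 (tnY k) = 0) ∧
      (∀ D0' : Derivation k (TnAlg k) (TnAlg k),
        D0' (tnX k) = 1 ∧ D0' (tnY k) = 0 → D0' = D0) ∧
      (∀ D : Derivation k (TnAlg k) (TnAlg k),
        D (tnY k) = 0 ∧ D = D (tnX k) • D0) := by
  refine ⟨tnDerivX k, ⟨tnDerivX_tnX k, derivation_tnY_eq_zero _⟩, fun D h => ?_, fun D => ?_⟩
  · exact tnAlg_derivation_ext (by rw [h.1, tnDerivX_tnX])
      (by rw [h.2, derivation_tnY_eq_zero])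
  · refine ⟨derivation_tnY_eq_zero D, tnAlg_derivation_ext ?_ ?_⟩
    · rw [Derivation.smul_apply, tnDerivX_tnX, smul_eq_mul, mul_one]
    · rw [derivation_tnY_eq_zero, derivation_tnY_eq_zero]
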